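/- arXiv:1606.06903 — 2 statements merged into one kernel-verified Lean document; each statement's English description precedes it below -/
import Mathlib

section
/- Let 𝐗 and 𝐘 be disjoint nonempty node sets in a DAG D. The following are equivalent: (i) there exists a set Z, disjoint from 𝐗 ∪ 𝐘, satisfying the adjustment criterion relative to (𝐗,𝐘) in D; (ii) Adjust(𝐗,𝐘,D) satisfies the adjustment criterion relative to (𝐗,𝐘) in D; (iii) Adjust(𝐗,𝐘,D) blocks every proper non-causal path from 𝐗 to 𝐘 in D. -/
attribute [local instance] Classical.propDecidable

/-- A finite directed acyclic graph on vertex type `V`. -/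
structure DAG (V : Type) [Fintype V] [DecidableEq V] where
  /-- the edge relation: `Edge a b` means there is a directed edge `a → b` -/
  Edge : V → V → Prop
  /-- there are no directed cycles -/
  acyclic : ∀ v, ¬ Relation.TransGen Edge v v

namespace DAG

variable {V : Type} [Fintype V] [DecidableEq V]

/-- two nodes are adjacent if they are joined by an edge in either direction -/
def Adj (D : DAG V) (a b : V) : Prop := D.Edge a b ∨ D.Edge b a

/-- `p` is a path from `x` to `y`: a list of distinct nodes, consecutive ones adjacent,
starting at `x` and ending at `y`. -/
def IsPathFrom (D : DAG V) (p : List V) (x y : V) : Prop :=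
  p.Nodup ∧ p.Chain' D.Adj ∧ p.head? = some x ∧ p.getLast? = some y

/-- a causal (directed) path: all edges point forward -/
def IsCausal (D : DAG V) (p : List V) : Prop := p.Chain' D.Edge

/-- descendants of a set of nodes (every node is its own descendant) -/
def Desc (D : DAG V) (S : Set V) : Set V :=
  {v | ∃ w ∈ S, Relation.ReflTransGen D.Edge w v}

/-- ancestors of a set of nodes (every node is its own ancestor) -/
def Anc (D : DAG V) (S : Set V) : Set V :=
  {v | ∃ w ∈ S, Relation.ReflTransGen D.Edge v w}

/-- `w` is a collider on the path `p`: both edges of `p` at `w` point into `w` -/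
def IsColliderOn (D : DAG V) (p : List V) (w : V) : Prop :=
  ∃ a b, [a, w, b] <:+: p ∧ D.Edge a w ∧ D.Edge b w

/-- `w` is a non-collider on `p`: a non-endpoint node of `p` that is not a collider on `p` -/
def IsNonColliderOn (D : DAG V) (p : List V) (w : V) : Prop :=
  (∃ a b, [a, w, b] <:+: p) ∧ ¬ D.IsColliderOn p w

/-- `Z` blocks the path `p`: some non-collider on `p` is in `Z`, or some collider on `p`
has no descendant in `Z`.  Otherwise `p` is d-connecting given `Z`. -/
def Blocks (D : DAG V) (Z : Set V) (p : List V) : Prop :=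
  (∃ w, D.IsNonColliderOn p w ∧ w ∈ Z) ∨
  (∃ w, D.IsColliderOn p w ∧ D.Desc {w} ∩ Z = ∅)

/-- `p` is a proper causal path from `X` to `Y` -/
def ProperCausalPath (D : DAG V) (X Y : Set V) (p : List V) : Prop :=
  (∃ x ∈ X, ∃ y ∈ Y, D.IsPathFrom p x y) ∧ (∀ v ∈ p.tail, v ∉ X) ∧ D.IsCausal p

/-- `p` is a proper non-causal path from `X` to `Y` -/
def ProperNonCausalPath (D : DAG V) (X Y : Set V) (p : List V) : Prop :=
  (∃ x ∈ X, ∃ y ∈ Y, D.IsPathFrom p x y) ∧ (∀ v ∈ p.tail, v ∉ X) ∧ ¬ D.IsCausal p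

/-- the forbidden set: all descendants of nodes `W ∉ X` lying on a proper causal path
from `X` to `Y` -/
def Forb (D : DAG V) (X Y : Set V) : Set V :=
  {v | ∃ p w, D.ProperCausalPath X Y p ∧ w ∈ p ∧ w ∉ X ∧
    Relation.ReflTransGen D.Edge w v}

/-- the adjustment criterion of Shpitser et al. / van der Zander et al. -/
def SatisfiesAC (D : DAG V) (X Y Z : Set V) : Prop :=
  Z ∩ D.Forb X Y = ∅ ∧ ∀ p, D.ProperNonCausalPath X Y p → D.Blocks Z p

/-- the constructive set `Adjust(X,Y,D)` -/
def AdjustSet (D : DAG V) (X Y : Set V) : Set V :=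
  D.Anc (X ∪ Y) \ (X ∪ Y ∪ D.Forb X Y)

/-- `Z` d-separates `X` and `Y` in `D`: `Z` blocks every path from `X` to `Y` -/
def DSep (D : DAG V) (X Y Z : Set V) : Prop :=
  ∀ x ∈ X, ∀ y ∈ Y, ∀ p, D.IsPathFrom p x y → D.Blocks Z p

/-- `p` is a back-door path from `x`: its first edge points into `x` -/
def IsBackdoorFrom (D : DAG V) (p : List V) (x : V) : Prop :=
  ∃ b rest, p = x :: b :: rest ∧ D.Edge b x

/-- Pearl's back-door criterion -/
def BackdoorCriterion (D : DAG V) (X Y Z : Set V) : Prop :=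
  Z ∩ D.Desc X = ∅ ∧
  ∀ x ∈ X, ∀ y ∈ Y, ∀ p, D.IsPathFrom p x y → D.IsBackdoorFrom p x → D.Blocks Z p

/-- the generalized back-door criterion of Maathuis and Colombo -/
def GenBackdoorCriterion (D : DAG V) (X Y Z : Set V) : Prop :=
  Z ∩ D.Desc X = ∅ ∧
  ∀ x ∈ X, ∀ y ∈ Y, ∀ p, D.IsPathFrom p x y → D.IsBackdoorFrom p x →
    D.Blocks ((Z ∪ X) \ {x}) p

end DAG


namespace DAG

variable {V : Type} [Fintype V] [DecidableEq V]

/-- `D.ColliderFree p`: no node of `p` has both of its edges on `p` pointing into it. -/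
def ColliderFree (D : DAG V) (p : List V) : Prop :=
  ∀ a w b, [a, w, b] <:+: p → D.Edge a w → ¬ D.Edge b w

theorem Edge.asymm {D : DAG V} {a b : V} (h : D.Edge a b) : ¬ D.Edge b a := fun h' =>
  D.acyclic a (.trans (.single h) (.single h'))

theorem pairwise_transGen {D : DAG V} {l : List V} (h : l.IsChain D.Edge) :
    l.Pairwise (Relation.TransGen D.Edge) :=
  (h.imp fun _ _ => Relation.TransGen.single).pairwise

theorem nodup_of_isChain {D : DAG V} {l : List V} (h : l.IsChain D.Edge) : l.Nodup :=
  (pairwise_transGen h).imp fun hab => by rintro rfl; exact D.acyclic _ hab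

theorem reflTransGen_of_isChain_concat {D : DAG V} {l : List V} {t u : V}
    (h : (l ++ [t]).IsChain D.Edge) (hu : u ∈ l ++ [t]) : Relation.ReflTransGen D.Edge u t := by
  have h' := List.pairwise_append.1 (pairwise_transGen h)
  rcases List.mem_append.1 hu with hu | hu
  · exact (h'.2.2 u hu t (by simp)).to_reflTransGen
  · rw [List.mem_singleton.1 hu]

/-- A node that reaches a set `T` from outside does so along a directed path which meets `T`
only at its last node. -/
theorem exists_isChain_first_mem {D : DAG V} {T : Set V} {v t : V}
    (h : Relation.ReflTransGen D.Edge v t) (ht : t ∈ T) (hv : v ∉ T) :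
    ∃ l t', t' ∈ T ∧ (v :: (l ++ [t'])).IsChain D.Edge ∧ ∀ u ∈ l, u ∉ T := by
  induction h using Relation.ReflTransGen.head_induction_on with
  | refl => exact absurd ht hv
  | @head a c hac _ ih =>
    by_cases hc : c ∈ T
    · exact ⟨[], c, hc, by simpa using hac, by simp⟩
    · obtain ⟨l, t', ht', hl, hlT⟩ := ih hc
      refine ⟨c :: l, t', ht', by simpa using ⟨hac, hl⟩, ?_⟩
      simpa using ⟨hc, hlT⟩

theorem colliderFree_of_isChain {D : DAG V} {l : List V} (h : l.IsChain D.Edge) :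
    D.ColliderFree l := by
  intro a w b hi _ hb
  have h' : D.Edge a w ∧ D.Edge w b := by simpa using h.infix hi
  exact Edge.asymm hb h'.2

theorem colliderFree_reverse_append {D : DAG V} {m : List V} :
    ∀ {v : V} {t : List V}, (v :: m).IsChain D.Edge → D.ColliderFree (v :: t) →
      D.ColliderFree (m.reverse ++ v :: t) := by
  induction m with
  | nil => intro v t _ h; simpa using h
  | cons c m ih =>
    intro v t hm h
    rw [List.isChain_cons_cons] at hm
    have hc : D.ColliderFree (c :: v :: t) := by
      intro a w b hi ha hb
      rcases List.infix_cons_iff.1 hi with hp | hi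
      · simp only [List.cons_prefix_cons] at hp
        obtain ⟨rfl, rfl, _⟩ := hp
        exact Edge.asymm ha hm.1
      · exact h a w b hi ha hb
    simpa using ih hm.2 hc

theorem isChain_adj_reverse_append {D : DAG V} {v : V} {m l : List V}
    (hm : (v :: m).IsChain D.Edge) (hl : (v :: l).IsChain D.Edge) :
    (m.reverse ++ v :: l).IsChain D.Adj := by
  have h₁ : (m.reverse ++ [v]).IsChain D.Adj := by
    rw [← List.reverse_cons, List.isChain_reverse]
    exact hm.imp fun _ _ h => Or.inr h
  have h₂ : (v :: l).IsChain D.Adj := hl.imp fun _ _ h => Or.inl h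
  rw [List.isChain_split]
  exact ⟨h₁, h₂⟩

/-- A set that blocks every proper non-causal path meets each fork `x ← ⋯ ← v → ⋯ → y`
that is proper relative to `X`. -/
theorem exists_mem_of_fork {D : DAG V} {X Y Z : Set V}
    (hZ : ∀ p, D.ProperNonCausalPath X Y p → D.Blocks Z p) {v x y : V} {m l : List V}
    (hx : x ∈ X) (hy : y ∈ Y) (hm : (v :: (m ++ [x])).IsChain D.Edge)
    (hl : (v :: l).IsChain D.Edge) (hlast : (v :: l).getLast? = some y)
    (hmX : ∀ u ∈ m, u ∉ X) (hlX : ∀ u ∈ v :: l, u ∉ X) (hdisj : ∀ u ∈ m, u ∉ l) :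
    ∃ u ∈ x :: (m ++ v :: l), u ∈ Z := by
  by_contra! hcon
  have hcf := colliderFree_reverse_append hm (colliderFree_of_isChain hl)
  have hadj := isChain_adj_reverse_append hm hl
  have hnm := nodup_of_isChain hm
  have hnl := nodup_of_isChain hl
  have hxl : x ∉ l := fun h => hlX x (by simp [h]) hx
  have hnodup : ((m ++ [x]).reverse ++ v :: l).Nodup := by
    refine List.Nodup.append (List.nodup_reverse.2 hnm.of_cons) hnl ?_
    intro u hu hu'
    rw [List.mem_reverse] at hu
    rcases List.mem_cons.1 hu' with rfl | hu'
    · exact (List.nodup_cons.1 hnm).1 hu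
    · rcases List.mem_append.1 hu with hu | hu
      · exact hdisj u hu hu'
      · exact hxl (List.mem_singleton.1 hu ▸ hu')
  have hnc : ¬ D.IsCausal ((m ++ [x]).reverse ++ v :: l) := by
    intro h
    obtain ⟨c, m', hc⟩ : ∃ c m', m ++ [x] = c :: m' := by cases m <;> simp
    rw [hc] at hm h
    have h' : (c :: v :: l).IsChain D.Edge := by
      change List.IsChain D.Edge _ at h
      rw [List.reverse_cons, List.append_assoc] at h
      exact h.right_of_append
    exact Edge.asymm (List.isChain_cons_cons.1 hm).1 (List.isChain_cons_cons.1 h').1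
  have hmem : ∀ a w b, [a, w, b] <:+: (m ++ [x]).reverse ++ v :: l → w ∉ Z := by
    intro a w b hi
    have hw := hi.subset (by simp : w ∈ [a, w, b])
    refine hcon w ?_
    simp only [List.reverse_append, List.mem_append, List.mem_reverse, List.mem_cons] at hw ⊢
    tauto
  rcases hZ _ ⟨⟨x, hx, y, hy, hnodup, hadj, by simp,
      by rw [List.getLast?_append_of_ne_nil _ (by simp), hlast]⟩, by
      intro u hu
      simp only [List.reverse_append, List.nil_append, List.reverse_cons,
        List.reverse_nil, List.cons_append, List.tail_cons, List.mem_append, List.mem_reverse] at hu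
      exact hu.elim (hmX u) (hlX u), hnc⟩ with ⟨w, ⟨⟨a, b, hi⟩, _⟩, hw⟩ | ⟨w, ⟨a, b, hi, ha, hb⟩, _⟩
  · exact hmem a w b hi hw
  · exact hcf a w b hi ha hb

theorem Forb.of_reflTransGen {D : DAG V} {X Y : Set V} {u v : V} (hu : u ∈ D.Forb X Y)
    (h : Relation.ReflTransGen D.Edge u v) : v ∈ D.Forb X Y := by
  obtain ⟨p, w, hp, hw, hwX, hwu⟩ := hu
  exact ⟨p, w, hp, hw, hwX, hwu.trans h⟩

theorem mem_forb_of_isChain {D : DAG V} {X Y : Set V} {x c y : V} {l : List V}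
    (hx : x ∈ X) (hxc : D.Edge x c) (hl : (c :: l).IsChain D.Edge)
    (hlast : (c :: l).getLast? = some y) (hy : y ∈ Y) (hlX : ∀ u ∈ c :: l, u ∉ X) :
    c ∈ D.Forb X Y := by
  have hch : (x :: c :: l).IsChain D.Edge := List.isChain_cons_cons.2 ⟨hxc, hl⟩
  exact ⟨x :: c :: l, c, ⟨⟨x, hx, y, hy, nodup_of_isChain hch, hch.imp fun _ _ h => Or.inl h,
    rfl, by simpa using hlast⟩, hlX, hch⟩, by simp, hlX c (by simp), .refl⟩

/-- If some adjustment set exists, no forbidden node is an ancestor of `X`. -/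
theorem not_reflTransGen_of_mem_forb {D : DAG V} {X Y Z : Set V} (hdisj : Disjoint Z (X ∪ Y))
    (hZ : D.SatisfiesAC X Y Z) {f x : V} (hf : f ∈ D.Forb X Y) (hx : x ∈ X) :
    ¬ Relation.ReflTransGen D.Edge f x := by
  intro hfx
  let S : Set V := {v | v ∈ D.Forb X Y ∧ (∃ x ∈ X, Relation.ReflTransGen D.Edge v x) ∧
    ∃ l, ∃ y ∈ Y, (v :: l).IsChain D.Edge ∧ (v :: l).getLast? = some y ∧ ∀ u ∈ v :: l, u ∉ X}
  have hS : S.Nonempty := by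
    obtain ⟨q, w, hq, hw, hwX, hwf⟩ := hf
    refine ⟨w, ⟨q, w, hq, hw, hwX, .refl⟩, ⟨x, hx, hwf.trans hfx⟩, ?_⟩
    obtain ⟨⟨x', _, y, hy, _, _, _, hlast⟩, htail, hcaus⟩ := hq
    obtain ⟨s, r, rfl⟩ := List.append_of_mem hw
    refine ⟨r, y, hy, List.IsChain.right_of_append hcaus, by simpa using hlast, ?_⟩
    intro u hu
    rcases List.mem_cons.1 hu with rfl | hu
    · exact hwX
    · exact htail u (by cases s <;> simp [hu])
  have : IsTrans V (Function.swap (Relation.TransGen D.Edge)) := ⟨fun _ _ _ h h' => h'.trans h⟩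
  have : Std.Irrefl (Function.swap (Relation.TransGen D.Edge)) := ⟨D.acyclic⟩
  have hwf : WellFounded (Function.swap (Relation.TransGen D.Edge)) :=
    Finite.wellFounded_of_trans_of_irrefl _
  obtain ⟨v, ⟨hvF, ⟨x', hx', hvx⟩, l, y, hy, hl, hlast, hlX⟩, hmin⟩ := hwf.has_min S hS
  obtain ⟨m, t, ht, hm, hmX⟩ := exists_isChain_first_mem hvx hx' (hlX v (by simp))
  have hvm : ∀ u ∈ m, Relation.ReflTransGen D.Edge v u := fun u hu =>
    ((List.pairwise_cons.1 (pairwise_transGen hm)).1 u (by simp [hu])).to_reflTransGen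
  have hvl : ∀ u ∈ l, Relation.TransGen D.Edge v u :=
    (List.pairwise_cons.1 (pairwise_transGen hl)).1
  obtain ⟨u, hu, huZ⟩ := exists_mem_of_fork hZ.2 ht hy hm hl hlast hmX hlX (by
    intro u hum hul
    refine hmin u ⟨Forb.of_reflTransGen hvF (hvm u hum), ⟨t, ht, ?_⟩, ?_⟩ (hvl u hul)
    · exact reflTransGen_of_isChain_concat hm.tail (by simp [hum])
    · obtain ⟨s, r, rfl⟩ := List.append_of_mem hul
      rw [← List.cons_append] at hl hlast
      rw [List.getLast?_append_of_ne_nil _ (by simp)] at hlast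
      exact ⟨r, y, hy, hl.right_of_append, hlast,
        fun u' hu' => hlX u' (List.mem_cons_of_mem _ (List.mem_append_right _ hu'))⟩)
  have huF : u ∉ D.Forb X Y := fun h => (Set.ext_iff.1 hZ.1 u).1 ⟨huZ, h⟩
  rcases List.mem_cons.1 hu with rfl | hu
  · exact Set.disjoint_left.1 hdisj huZ (Or.inl ht)
  · refine huF (Forb.of_reflTransGen hvF ?_)
    rcases List.mem_append.1 hu with hu | hu
    · exact hvm u hu
    · rcases List.mem_cons.1 hu with rfl | hu
      · exact .refl
      · exact (hvl u hu).to_reflTransGen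

theorem not_edge_of_blocks {D : DAG V} {X Y Z : Set V} (hdisj : Disjoint Z (X ∪ Y))
    (hZ : ∀ p, D.ProperNonCausalPath X Y p → D.Blocks Z p) {x y : V} (hx : x ∈ X) (hy : y ∈ Y)
    (hyX : y ∉ X) : ¬ D.Edge y x := by
  intro h
  obtain ⟨u, hu, huZ⟩ := exists_mem_of_fork (m := []) (l := []) hZ hx hy (by simpa using h)
    (by simp) rfl (by simp) (by simpa using hyX) (by simp)
  refine Set.disjoint_left.1 hdisj huZ ?_
  simp only [List.nil_append, List.mem_cons, List.not_mem_nil, or_false] at hu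
  rcases hu with rfl | rfl
  · exact Or.inl hx
  · exact Or.inr hy

/-- If some adjustment set exists, the collider of a path `x → c ← y` is either forbidden or not
an ancestor of `X ∪ Y`. -/
theorem notMem_anc_of_edge_edge {D : DAG V} {X Y Z : Set V} (hdisj : Disjoint Z (X ∪ Y))
    (hZ : ∀ p, D.ProperNonCausalPath X Y p → D.Blocks Z p) {x c y : V} (hx : x ∈ X) (hy : y ∈ Y)
    (hyX : y ∉ X) (hcX : c ∉ X) (hxc : D.Edge x c) (hyc : D.Edge y c) (hcF : c ∉ D.Forb X Y) :
    c ∉ D.Anc (X ∪ Y) := by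
  rintro ⟨t, ht, hct⟩
  have hcZ : D.Desc {c} ∩ Z = ∅ := by
    have hne : x ≠ y := fun e => hyX (e ▸ hx)
    have hne' : x ≠ c := fun e => hcX (e ▸ hx)
    have hne'' : c ≠ y := fun e => D.acyclic c (.single (by rw [← e] at hyc; exact hyc))
    have hinf : ∀ a w b, [a, w, b] <:+: [x, c, y] → w = c := fun a w b h => by
      have := h.eq_of_length rfl
      simp_all
    have hnc : ¬ D.IsCausal [x, c, y] := fun h =>
      Edge.asymm hyc (List.isChain_pair.1 (List.isChain_cons_cons.1 h).2)
    rcases hZ [x, c, y] ⟨⟨x, hx, y, hy, by simp [hne, hne', hne''],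
        show List.IsChain D.Adj _ by simp [Adj, hxc, hyc], rfl, rfl⟩, by simp [hcX, hyX], hnc⟩
      with ⟨w, ⟨⟨a, b, hi⟩, hw⟩, _⟩ | ⟨w, ⟨a, b, hi, _⟩, hw⟩
    · obtain rfl := hinf a w b hi
      exact absurd ⟨x, y, List.infix_rfl, hxc, hyc⟩ hw
    · rwa [hinf a w b hi] at hw
  have hcY : c ∉ Y := fun hc => hcF (mem_forb_of_isChain (l := []) hx hxc (by simp) rfl hc
    (by simpa using hcX))
  obtain ⟨m, t', ht', hm, hmXY⟩ :=
    exists_isChain_first_mem hct ht (by rintro (h | h) <;> contradiction)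
  have hcm : ∀ u ∈ c :: m, Relation.ReflTransGen D.Edge c u := by
    intro u hu
    rcases List.mem_cons.1 hu with rfl | hu
    · exact .refl
    · exact ((List.pairwise_cons.1 (pairwise_transGen hm)).1 u (by simp [hu])).to_reflTransGen
  have hcmX : ∀ u ∈ c :: m, u ∉ X := by
    intro u hu
    rcases List.mem_cons.1 hu with rfl | hu
    · exact hcX
    · exact fun h => hmXY u hu (Or.inl h)
  have ht'X : t' ∈ X := by
    by_contra hn
    refine hcF (mem_forb_of_isChain (l := m ++ [t']) hx hxc hm (y := t') ?_
      (ht'.resolve_left hn) ?_)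
    · rw [← List.cons_append, List.getLast?_concat]
    · intro u hu
      rw [← List.cons_append, List.mem_append, List.mem_singleton] at hu
      rcases hu with hu | rfl
      · exact hcmX u hu
      · exact hn
  obtain ⟨u, hu, huZ⟩ := exists_mem_of_fork (v := y) (m := c :: m) (l := []) hZ ht'X hy
    (by simpa using ⟨hyc, hm⟩) (by simp) rfl hcmX (by simpa using hyX) (by simp)
  have hXY := Set.disjoint_left.1 hdisj huZ
  rcases List.mem_cons.1 hu with rfl | hu
  · exact hXY (Or.inl ht'X)
  · rcases List.mem_append.1 hu with hu | hu
    · exact (Set.ext_iff.1 hcZ u).1 ⟨⟨c, rfl, hcm u hu⟩, huZ⟩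
    · exact hXY (Or.inr (List.mem_singleton.1 hu ▸ hy))

/-- A path that leaves a descendant-closed set `S` containing its first node along a directed
edge, and has no collider in `S`, is directed and stays in `S`. -/
theorem isChain_edge_of_colliders_notMem {D : DAG V} {S : Set V}
    (hS : ∀ a b, D.Edge a b → a ∈ S → b ∈ S) {r : List V} :
    ∀ {a b : V}, (a :: b :: r).IsChain D.Adj →
      (∀ u w v, [u, w, v] <:+: a :: b :: r → D.Edge u w → D.Edge v w → w ∉ S) →
      a ∈ S → D.Edge a b → (a :: b :: r).IsChain D.Edge ∧ ∀ v ∈ a :: b :: r, v ∈ S := by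
  induction r with
  | nil =>
    intro a b _ _ ha hab
    simpa [hab, ha] using hS a b hab ha
  | cons c r ih =>
    intro a b hadj hcol ha hab
    have hb := hS a b hab ha
    rw [List.isChain_cons_cons] at hadj
    have hbc : D.Edge b c := (List.isChain_cons_cons.1 hadj.2).1.resolve_right fun hcb =>
      hcol a b c ⟨[], r, rfl⟩ hab hcb hb
    obtain ⟨h₁, h₂⟩ := ih hadj.2 (fun u w v hi => hcol u w v (List.infix_cons hi)) hb hbc
    exact ⟨List.isChain_cons_cons.2 ⟨hab, h₁⟩, List.forall_mem_cons.2 ⟨ha, h₂⟩⟩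

theorem not_isColliderOn_of_infix {D : DAG V} {p : List V} (hp : p.Nodup) {a w b : V}
    (hi : [a, w, b] <:+: p) (h : ¬ (D.Edge a w ∧ D.Edge b w)) : ¬ D.IsColliderOn p w := by
  rintro ⟨a', b', ⟨s', t', hi'⟩, ha', hb'⟩
  obtain ⟨s, t, rfl⟩ := hi
  have hn : w ∉ s ++ [a] ∧ w ∉ b :: t := by
    simp only [List.append_assoc, List.cons_append, List.nil_append, List.nodup_append,
      List.nodup_cons, List.mem_cons] at hp
    grind
  have e : (s ++ [a]) ++ w :: (b :: t) = (s' ++ [a']) ++ w :: (b' :: t') := by simpa using hi'.symm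
  obtain ⟨e₁, e₂⟩ := (List.append_cons_inj_of_notMem hn.1 hn.2).1 e
  obtain rfl : a = a' := by simpa using (List.append_inj_right' e₁ rfl)
  obtain rfl : b = b' := (List.cons.inj e₂.2).1
  exact h ⟨ha', hb'⟩

theorem adjustSet_inter_forb (D : DAG V) (X Y : Set V) : D.AdjustSet X Y ∩ D.Forb X Y = ∅ := by
  ext u
  simp only [Set.mem_inter_iff, Set.mem_empty_iff_false, iff_false, not_and]
  exact fun hu hF => hu.2 (Or.inr hF)

/-- If some adjustment set exists, `Adjust(X,Y,D)` blocks every proper non-causal path. -/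
theorem adjustSet_blocks {D : DAG V} {X Y Z : Set V} (hdisj : Disjoint Z (X ∪ Y))
    (hZ : D.SatisfiesAC X Y Z) {p : List V} (hp : D.ProperNonCausalPath X Y p) :
    D.Blocks (D.AdjustSet X Y) p := by
  by_contra hopen
  obtain ⟨⟨x, hx, y, hy, hnodup, hadj, hhead, hlast⟩, htail, hnc⟩ := hp
  change p.IsChain D.Adj at hadj
  have hcol : ∀ a w b, [a, w, b] <:+: p → D.Edge a w → D.Edge b w →
      w ∉ D.Forb X Y ∧ w ∈ D.Anc (X ∪ Y) := by
    intro a w b hi ha hb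
    have hne : D.Desc {w} ∩ D.AdjustSet X Y ≠ ∅ := fun h =>
      hopen (Or.inr ⟨w, ⟨a, b, hi, ha, hb⟩, h⟩)
    obtain ⟨u, ⟨w', rfl, hwu⟩, ⟨t, ht, hut⟩, hu⟩ := Set.nonempty_iff_ne_empty.2 hne
    exact ⟨fun hF => hu (Or.inr (Forb.of_reflTransGen hF hwu)), t, ht, hwu.trans hut⟩
  have hncol : ∀ a w b, [a, w, b] <:+: p → ¬ (D.Edge a w ∧ D.Edge b w) → w ∉ X →
      w ∈ D.Anc (X ∪ Y) → w ∈ Y ∨ w ∈ D.Forb X Y := by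
    intro a w b hi h hwX hwA
    by_contra! hn
    refine hopen (Or.inl ⟨w, ⟨⟨a, b, hi⟩, not_isColliderOn_of_infix hnodup hi h⟩, hwA, ?_⟩)
    rintro ((h | h) | h)
    exacts [hwX h, hn.1 h, hn.2 h]
  match p, hhead with
  | [_], _ => exact hnc (List.isChain_singleton _)
  | [_, b], rfl =>
    obtain rfl : b = y := by simpa using hlast
    have hba : D.Edge b x := (List.isChain_pair.1 hadj).resolve_left fun h =>
      hnc (List.isChain_pair.2 h)
    exact not_edge_of_blocks hdisj hZ.2 hx hy (htail b (by simp)) hba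
  | _ :: b :: c :: r, rfl =>
    have hi : [x, b, c] <:+: x :: b :: c :: r := ⟨[], r, rfl⟩
    have hbX := htail b (by simp)
    have hcX := htail c (by simp)
    rw [List.isChain_cons_cons] at hadj
    rcases hadj.1 with hxb | hbx
    · rcases (List.isChain_cons_cons.1 hadj.2).1 with hbc | hcb
      · have hbA : b ∈ D.Anc (X ∪ Y) := by
          by_contra hbA
          refine (isChain_edge_of_colliders_notMem (S := (D.Anc (X ∪ Y))ᶜ) ?_ hadj.2 ?_ hbA hbc).2
            y (List.mem_of_getLast? (by simpa using hlast)) ⟨y, Or.inr hy, .refl⟩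
          · rintro a b hab ha ⟨t, ht, hbt⟩
            exact ha ⟨t, ht, .head hab hbt⟩
          · exact fun u w v hi hu hv hw => hw (hcol u w v (List.infix_cons hi) hu hv).2
        have hbF : b ∈ D.Forb X Y := by
          refine (hncol x b c hi (fun h => Edge.asymm hbc h.2) hbX hbA).elim (fun hbY => ?_) id
          exact mem_forb_of_isChain (l := []) hx hxb (by simp) rfl hbY (by simpa using hbX)
        refine hnc (List.isChain_cons_cons.2 ⟨hxb, (isChain_edge_of_colliders_notMem
          (S := D.Forb X Y) ?_ hadj.2 ?_ hbF hbc).1⟩)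
        · exact fun a b hab ha => Forb.of_reflTransGen ha (.single hab)
        · exact fun u w v hi hu hv => (hcol u w v (List.infix_cons hi) hu hv).1
      · obtain ⟨hbF, hbA⟩ := hcol x b c hi hxb hcb
        have hcY : c ∈ Y := by
          match r with
          | [] =>
            obtain rfl : c = y := by simpa using hlast
            exact hy
          | d :: r =>
            obtain ⟨t, ht, hbt⟩ := hbA
            refine (hncol b c d ⟨[x], r, rfl⟩ (fun h => Edge.asymm hcb h.1) hcX
              ⟨t, ht, .head hcb hbt⟩).resolve_right fun hcF => ?_
            exact hbF (Forb.of_reflTransGen hcF (.single hcb))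
        exact notMem_anc_of_edge_edge hdisj hZ.2 hx hcY hcX hbX hxb hcb hbF hbA
    · rcases hncol x b c hi (fun h => Edge.asymm hbx h.1) hbX ⟨x, Or.inl hx, .single hbx⟩
        with hbY | hbF
      · exact not_edge_of_blocks hdisj hZ.2 hx hbY hbX hbx
      · exact not_reflTransGen_of_mem_forb hdisj hZ hbF hx (.single hbx)

/-- The following are equivalent: (i) some set disjoint from `X ∪ Y`
satisfies the adjustment criterion relative to `(X, Y)` in `D`; (ii) `Adjust(X,Y,D)`
satisfies the adjustment criterion relative to `(X, Y)` in `D`; (iii) `Adjust(X,Y,D)`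
blocks every proper non-causal path from `X` to `Y` in `D`. -/
theorem adjustSet_characterization
    (D : DAG V) (X Y : Set V)
    (hXY : Disjoint X Y) (hX : X.Nonempty) (hY : Y.Nonempty) :
    ((∃ Z, Disjoint Z (X ∪ Y) ∧ D.SatisfiesAC X Y Z) ↔
        D.SatisfiesAC X Y (D.AdjustSet X Y)) ∧
    (D.SatisfiesAC X Y (D.AdjustSet X Y) ↔
        ∀ p, D.ProperNonCausalPath X Y p → D.Blocks (D.AdjustSet X Y) p) := by
  have hcomp : (∀ p, D.ProperNonCausalPath X Y p → D.Blocks (D.AdjustSet X Y) p) →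
      D.SatisfiesAC X Y (D.AdjustSet X Y) := fun h => ⟨adjustSet_inter_forb D X Y, h⟩
  refine ⟨⟨?_, fun h => ⟨_, ?_, h⟩⟩, fun h => h.2, hcomp⟩
  · rintro ⟨Z, hdisj, hZ⟩
    exact hcomp fun p hp => adjustSet_blocks hdisj hZ hp
  · exact Set.disjoint_left.2 fun u hu huXY => hu.2 (Or.inl huXY)

end DAG
end

section
/- Let 𝐗 and 𝐘 be disjoint nonempty node sets in a DAG D. There exists a back-door set relative to (𝐗,𝐘) in D if and only if the set Adjust(𝐗,𝐘,D) \ De(𝐗,D) satisfies Pearl's back-door criterion relative to (𝐗,𝐘) in D. -/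
attribute [local instance] Classical.propDecidable

namespace DAG

variable {V : Type} [Fintype V] [DecidableEq V]

theorem infix_triple_unique {α : Type*} {p : List α} (hp : p.Nodup) {a b a' b' w : α}
    (h : [a, w, b] <:+: p) (h' : [a', w, b'] <:+: p) : a = a' ∧ b = b' := by
  obtain ⟨s, t, rfl⟩ := h
  obtain ⟨s', t', h'⟩ := h'
  have hsplit : (s ++ [a]) ++ w :: (b :: t) = (s' ++ [a']) ++ w :: (b' :: t') := by
    simpa using h'.symm
  have hnodup : ((s ++ [a]) ++ w :: (b :: t)).Nodup := by simpa using hp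
  have hw : w ∉ s ++ [a] := fun hmem =>
    (List.nodup_append.1 hnodup).2.2 w hmem w List.mem_cons_self rfl
  have hw' : w ∉ b :: t := (List.nodup_cons.1 (List.nodup_append.1 hnodup).2.1).1
  obtain ⟨h1, -, h2⟩ := (List.append_cons_inj_of_notMem hw hw').1 hsplit
  exact ⟨(List.append_inj' h1 rfl).2 |> List.head_eq_of_cons_eq, List.head_eq_of_cons_eq h2⟩

theorem mem_head_or_getLast_or_interior {α : Type*} {p : List α} {v : α} (hv : v ∈ p) :
    p.head? = some v ∨ p.getLast? = some v ∨ ∃ a b, [a, v, b] <:+: p := by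
  obtain ⟨s, t, rfl⟩ := List.append_of_mem hv
  rcases s.eq_nil_or_concat with rfl | ⟨s, a, rfl⟩
  · simp
  · cases t with
    | nil => simp
    | cons b t => exact .inr (.inr ⟨a, b, s, t, by simp⟩)

theorem wellFounded_flip_edge (D : DAG V) : WellFounded (fun a b => D.Edge b a) := by
  have : Std.Irrefl (Relation.TransGen D.Edge) := ⟨D.acyclic⟩
  have hwf : WellFounded (fun a b => Relation.TransGen D.Edge b a) :=
    Finite.wellFounded_of_trans_of_irrefl _
  exact Subrelation.wf (fun h => Relation.TransGen.single h) hwf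

theorem edge_asymm (D : DAG V) {a b : V} (h : D.Edge a b) : ¬ D.Edge b a :=
  fun h' => D.acyclic a (.tail (.single h) h')

theorem subset_desc (D : DAG V) (S : Set V) : S ⊆ D.Desc S := fun v hv => ⟨v, hv, .refl⟩

theorem desc_of_reachable (D : DAG V) {S : Set V} {a b : V} (ha : a ∈ D.Desc S)
    (h : Relation.ReflTransGen D.Edge a b) : b ∈ D.Desc S :=
  ha.imp fun _ hw => ⟨hw.1, hw.2.trans h⟩

theorem anc_of_reachable (D : DAG V) {S : Set V} {a b : V} (hb : b ∈ D.Anc S)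
    (h : Relation.ReflTransGen D.Edge a b) : a ∈ D.Anc S :=
  hb.imp fun _ hw => ⟨hw.1, h.trans hw.2⟩

/-- A proper causal path starts in `X`, so every forbidden node descends from `X`. -/
theorem forb_subset_desc (D : DAG V) (X Y : Set V) : D.Forb X Y ⊆ D.Desc X := by
  rintro v ⟨p, w, ⟨⟨x, hx, y, -, hpath⟩, -, hcausal⟩, hw, -, hwv⟩
  refine D.desc_of_reachable ⟨x, hx, ?_⟩ hwv
  obtain ⟨l, rfl⟩ : ∃ l, p = x :: l := by
    cases p with
    | nil => simp at hw
    | cons c l => exact ⟨l, by simpa using hpath.2.2.1⟩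
  rcases List.mem_cons.1 hw with rfl | hw
  · exact .refl
  · have hpw := List.isChain_iff_pairwise.1
      (List.IsChain.imp (fun _ _ => Relation.ReflTransGen.single) hcausal)
    exact List.rel_of_pairwise_cons hpw hw

theorem isNonColliderOn_of_infix {D : DAG V} {p q : List V} {w : V} (hpq : p <:+: q)
    (hq : q.Nodup) (h : D.IsNonColliderOn p w) : D.IsNonColliderOn q w := by
  obtain ⟨⟨a, b, hab⟩, hnc⟩ := h
  refine ⟨⟨a, b, hab.trans hpq⟩, ?_⟩
  rintro ⟨a', b', hab', ha, hb⟩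
  obtain ⟨rfl, rfl⟩ := infix_triple_unique hq (hab.trans hpq) hab'
  exact hnc ⟨a, b, hab, ha, hb⟩

theorem blocks_of_infix {D : DAG V} {Z : Set V} {p q : List V} (hpq : p <:+: q)
    (hq : q.Nodup) (h : D.Blocks Z p) : D.Blocks Z q := by
  rcases h with ⟨w, hw, hZ⟩ | ⟨w, ⟨a, b, hab, hw⟩, hZ⟩
  · exact .inl ⟨w, isNonColliderOn_of_infix hpq hq hw, hZ⟩
  · exact .inr ⟨w, ⟨a, b, hab.trans hpq, hw⟩, hZ⟩

/-- On a path, every node is an ancestor of an endpoint or of a collider. -/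
theorem mem_anc_of_mem_path {D : DAG V} {S : Set V} {p : List V} {x y : V}
    (hp : D.IsPathFrom p x y) (hx : x ∈ D.Anc S) (hy : y ∈ D.Anc S)
    (hcol : ∀ w, D.IsColliderOn p w → w ∈ D.Anc S) : ∀ v ∈ p, v ∈ D.Anc S := by
  intro v
  induction v using D.wellFounded_flip_edge.induction with
  | _ v ih =>
    intro hv
    rcases mem_head_or_getLast_or_interior hv with h | h | ⟨a, b, hab⟩
    · obtain rfl : x = v := by simpa using hp.2.2.1.symm.trans h
      exact hx
    · obtain rfl : y = v := by simpa using hp.2.2.2.symm.trans h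
      exact hy
    · by_cases hc : D.IsColliderOn p v
      · exact hcol v hc
      have hchain : [a, v, b].IsChain D.Adj := List.IsChain.infix hp.2.1 hab
      have hadj : D.Adj a v ∧ D.Adj v b := by simpa using hchain
      by_cases hva : D.Edge v a
      · exact D.anc_of_reachable (ih a hva (hab.subset (by simp))) (.single hva)
      · have hvb : D.Edge v b := by
          by_contra hvb
          exact hc ⟨a, b, hab, hadj.1.resolve_right hva, hadj.2.resolve_left hvb⟩
        exact D.anc_of_reachable (ih b hvb (hab.subset (by simp))) (.single hvb)

/-- If every non-collider on a path starting in `X` descends from `X`, then so does every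
collider. -/
theorem collider_mem_desc {D : DAG V} {X : Set V} {p : List V} {x y w : V}
    (hp : D.IsPathFrom p x y) (hx : x ∈ X)
    (hnc : ∀ v, D.IsNonColliderOn p v → v ∈ D.Desc X) (hw : D.IsColliderOn p w) :
    w ∈ D.Desc X := by
  obtain ⟨a, b, ⟨s, t, hst⟩, haw, -⟩ := hw
  suffices ha : a ∈ D.Desc X from D.desc_of_reachable ha (.single haw)
  rcases s.eq_nil_or_concat with rfl | ⟨s, c, rfl⟩
  · have hax : a = x := by simpa [← hst] using hp.2.2.1
    exact hax ▸ D.subset_desc X hx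
  · have hinf : [c, a, w] <:+: p := ⟨s, b :: t, by simpa using hst⟩
    refine hnc a ⟨⟨c, w, hinf⟩, ?_⟩
    rintro ⟨c', w', hinf', -, hwa⟩
    obtain ⟨rfl, rfl⟩ := infix_triple_unique hp.1 hinf hinf'
    exact D.edge_asymm haw hwa

/-- A back-door path whose interior avoids `Y` and which `AdjustSet X Y \ Desc X` leaves open
has no colliders and only descendants of `X` in its interior, so no set of non-descendants
of `X` blocks it. -/
theorem adjustSet_diff_desc_blocks_of_interior {D : DAG V} {X Y Z : Set V} {p : List V}
    {x y : V} (hp : D.IsPathFrom p x y) (hx : x ∈ X) (hy : y ∈ Y)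
    (hint : ∀ v a b, [a, v, b] <:+: p → v ∉ Y) (hZ : Z ∩ D.Desc X = ∅)
    (hblocks : D.Blocks Z p) : D.Blocks (D.AdjustSet X Y \ D.Desc X) p := by
  by_contra hopen
  simp only [Blocks, not_or, not_exists, not_and] at hopen
  obtain ⟨hopen_nc, hopen_col⟩ := hopen
  have hcol : ∀ w, D.IsColliderOn p w → w ∈ D.Anc (X ∪ Y) ∧ w ∉ D.Desc X := by
    intro w hw
    obtain ⟨v, ⟨_, rfl, hwv⟩, hvA, hvD⟩ := Set.nonempty_iff_ne_empty.2 (hopen_col w hw)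
    exact ⟨D.anc_of_reachable hvA.1 hwv, fun h => hvD (D.desc_of_reachable h hwv)⟩
  have hanc := mem_anc_of_mem_path hp (S := X ∪ Y) ⟨x, .inl hx, .refl⟩ ⟨y, .inr hy, .refl⟩
    fun w hw => (hcol w hw).1
  have hnc : ∀ v, D.IsNonColliderOn p v → v ∈ D.Desc X := by
    intro v hv
    by_contra hvD
    obtain ⟨a, b, hab⟩ := hv.1
    refine hopen_nc v hv ⟨⟨hanc v (hab.subset (by simp)), ?_⟩, hvD⟩
    rintro ((h | h) | h)
    · exact hvD (D.subset_desc X h)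
    · exact hint v a b hab h
    · exact hvD (D.forb_subset_desc X Y h)
  rcases hblocks with ⟨w, hw, hwZ⟩ | ⟨w, hw, -⟩
  · exact Set.eq_empty_iff_forall_notMem.1 hZ w ⟨hwZ, hnc w hw⟩
  · exact (hcol w hw).2 (collider_mem_desc hp hx hnc hw)

/-- A back-door path from `x` with an interior node in `Y` has a strictly shorter initial
segment that is a back-door path ending there. -/
theorem exists_backdoor_prefix {D : DAG V} {p : List V} {x y v a b : V}
    (hp : D.IsPathFrom p x y) (hbd : D.IsBackdoorFrom p x) (hab : [a, v, b] <:+: p) :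
    ∃ q, q <:+: p ∧ q.length < p.length ∧ D.IsPathFrom q x v ∧ D.IsBackdoorFrom q x := by
  obtain ⟨s, t, rfl⟩ := hab
  have hinf : s ++ [a, v] <:+: s ++ [a, v, b] ++ t := ⟨[], b :: t, by simp⟩
  refine ⟨s ++ [a, v], hinf, by simp,
    ⟨hp.1.sublist hinf.sublist, List.IsChain.infix hp.2.1 hinf, ?_, by simp⟩, ?_⟩
  · have := hp.2.2.1
    cases s <;> simpa using this
  · obtain ⟨c, rest, h, hc⟩ := hbd
    match s with
    | [] => exact ⟨v, [], by simp_all, by simp_all⟩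
    | [d] => exact ⟨a, [v], by simp_all, by simp_all⟩
    | d :: e :: s => exact ⟨e, s ++ [a, v], by simp_all, by simp_all⟩

/-- There exists a back-door set relative to `(X, Y)` in `D` iff
`Adjust(X,Y,D) \ De(X,D)` satisfies Pearl's back-door criterion relative to `(X, Y)`
in `D`. -/
theorem constructive_backdoor_set
    (D : DAG V) (X Y : Set V)
    (hXY : Disjoint X Y) (hX : X.Nonempty) (hY : Y.Nonempty) :
    (∃ Z, D.BackdoorCriterion X Y Z) ↔
      D.BackdoorCriterion X Y (D.AdjustSet X Y \ D.Desc X) := by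
  refine ⟨?_, fun h => ⟨_, h⟩⟩
  rintro ⟨Z, hZ, hblocks⟩
  refine ⟨Set.sdiff_inter_self, fun x hx y hy p => ?_⟩
  induction hn : p.length using Nat.strong_induction_on generalizing p y with
  | _ n ih =>
    intro hp hbd
    by_cases hint : ∀ v a b, [a, v, b] <:+: p → v ∉ Y
    · exact adjustSet_diff_desc_blocks_of_interior hp hx hy hint hZ
        (hblocks x hx y hy p hp hbd)
    · push Not at hint
      obtain ⟨v, a, b, hab, hv⟩ := hint
      obtain ⟨q, hqp, hlen, hq, hqbd⟩ := exists_backdoor_prefix hp hbd hab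
      exact blocks_of_infix hqp hp.1 (ih q.length (hn ▸ hlen) v hv q rfl hq hqbd)

end DAG
end
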